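/- Let k > 2 be an integer and U = {z ∈ ℂ \ {0} : z^k ≠ 1}. On U, let G(z) = z^{k−1} and γ(z) = (k−2)/(2z) − k z^{k−1}/(z^k − 1) (corresponding to the Jorge–Meeks k-noid, whose Hopf differential is −(k−1)z^{k−2}/(z^k−1)² dz²). Then the entropy coefficients satisfy p₇ + a_k·p₅·p₂ + b_k·p₄·p₃ + c_k·p₃·p₂² = 0 on U, where a_k = 16(3k−2)(k−2)/(3k²−16k+8), b_k = 8(27k⁴−144k³−56k²+128k−32)/((3k²−16k+8)(k−2)(3k−2)) and c_k = 192k²/(3k²−16k+8); hence the k-noids are minimal surfaces of degree 7. -/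

import Mathlib

/-- The classical Schwarzian derivative `S(f) = f‴/f′ − (3/2)(f″/f′)²`. -/
noncomputable def schwarzian (f : ℂ → ℂ) (z : ℂ) : ℂ :=
  iteratedDeriv 3 f z / deriv f z - (3 / 2) * (iteratedDeriv 2 f z / deriv f z) ^ 2

/-- The entropy coefficients: `entropy G γ k` is `p_{k+2}`, with
`p₂ = S(G) + γ²/2 − γ′` and `p_{ℓ+1} = p_ℓ′ − ℓ·γ·p_ℓ`. -/
noncomputable def entropy (G γ : ℂ → ℂ) : ℕ → ℂ → ℂ
  | 0 => fun z => schwarzian G z + (γ z) ^ 2 / 2 - deriv γ z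
  | (k + 1) => fun z =>
      deriv (entropy G γ k) z - ((k : ℂ) + 2) * γ z * entropy G γ k z

open Polynomial

/-- The function `s = 1 / (w ^ k - 1) + 1 / 2` satisfies `w * s' = -k * (s ^ 2 - 1 / 4)`. -/
lemma hasDerivAt_one_div_pow_sub_one (k : ℕ) (hk : 0 < k) (w : ℂ) (hw : w ≠ 0)
    (hw1 : w ^ k ≠ 1) :
    HasDerivAt (fun w : ℂ => 1 / (w ^ k - 1) + 1 / 2)
      (-(k : ℂ) * ((1 / (w ^ k - 1) + 1 / 2) ^ 2 - 1 / 4) / w) w := by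
  have hsub : w ^ k - 1 ≠ 0 := sub_ne_zero.mpr hw1
  have h := ((((hasDerivAt_pow k w).sub_const 1).inv hsub).add_const (1 / 2 : ℂ))
  obtain ⟨m, rfl⟩ := Nat.exists_eq_succ_of_ne_zero hk.ne'
  simp only [one_div] at h ⊢
  refine h.congr_deriv ?_
  simp only [Nat.succ_eq_add_one, Nat.add_sub_cancel] at hsub ⊢
  field_simp
  ring

/-- On `U = {w ≠ 0 : w ^ k ≠ 1}`, the entropy recursion for the `k`-noid becomes a recursion for
polynomials in `1 / (w ^ k - 1) + 1 / 2`. -/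
lemma entropy_succ_knoid (k : ℕ) (hk : 0 < k) (G γ : ℂ → ℂ)
    (hγ : ∀ w : ℂ, w ≠ 0 → w ^ k ≠ 1 →
      γ w = (-1 - (k : ℂ) * (1 / (w ^ k - 1) + 1 / 2)) / w)
    (j : ℕ) (P Q : ℂ[X])
    (hP : ∀ w : ℂ, w ≠ 0 → w ^ k ≠ 1 →
      entropy G γ j w = P.eval (1 / (w ^ k - 1) + 1 / 2) / w ^ (j + 2))
    (hQ : ∀ s : ℂ, Q.eval s = -(k : ℂ) * (s ^ 2 - 1 / 4) * P.derivative.eval s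
      + ((j : ℂ) + 2) * k * s * P.eval s) :
    ∀ w : ℂ, w ≠ 0 → w ^ k ≠ 1 →
      entropy G γ (j + 1) w
        = Q.eval (1 / (w ^ k - 1) + 1 / 2) / w ^ (j + 1 + 2) := by
  intro w hw hw1
  have hloc : entropy G γ j =ᶠ[nhds w]
      fun w => P.eval (1 / (w ^ k - 1) + 1 / 2) / w ^ (j + 2) := by
    filter_upwards [isOpen_ne.mem_nhds hw,
      (isOpen_ne.preimage (continuous_pow k)).mem_nhds hw1] with y hy hy1
    exact hP y hy hy1
  have hs := hasDerivAt_one_div_pow_sub_one k hk w hw hw1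
  have hd := ((P.hasDerivAt (1 / (w ^ k - 1) + 1 / 2)).comp w hs).div
    (hasDerivAt_pow (j + 2) w) (pow_ne_zero _ hw)
  have hd' : deriv (entropy G γ j) w = _ := hloc.deriv_eq.trans hd.deriv
  change deriv (entropy G γ j) w - ((j : ℂ) + 2) * γ w * entropy G γ j w = _
  rw [hd', hP w hw hw1, hγ w hw hw1]
  simp only [hQ, Function.comp_apply]
  generalize 1 / (w ^ k - 1) + 1 / 2 = s
  simp only [show j + 2 - 1 = j + 1 from rfl]
  push_cast
  field_simp
  ring

/-- The Schwarzian derivative of `w ^ n` is `(1 - n ^ 2) / (2 * w ^ 2)`. -/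
lemma schwarzian_pow (n : ℕ) (hn : n ≠ 0) (w : ℂ) (hw : w ≠ 0) :
    schwarzian (fun w => w ^ n) w = (1 - (n : ℂ) ^ 2) / (2 * w ^ 2) := by
  have hn' : (n : ℂ) ≠ 0 := by exact_mod_cast hn
  have h1 (m : ℕ) : (m : ℂ) * w ^ (m - 1) = m * w ^ m / w := by
    rcases m with _ | m
    · simp
    · rw [Nat.add_sub_cancel, pow_succ]
      field_simp
  have e1 : deriv (fun w : ℂ => w ^ n) = fun w => (n : ℂ) * w ^ (n - 1) := by
    ext y
    simp
  have e2 : iteratedDeriv 2 (fun w : ℂ => w ^ n)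
      = fun w => (n : ℂ) * (((n - 1 : ℕ) : ℂ) * w ^ (n - 1 - 1)) := by
    rw [iteratedDeriv_succ, iteratedDeriv_one, e1]
    ext y
    simp
  have e3 : iteratedDeriv 3 (fun w : ℂ => w ^ n) w
      = (n : ℂ) * (((n - 1 : ℕ) : ℂ) * (((n - 1 - 1 : ℕ) : ℂ) * w ^ (n - 1 - 1 - 1))) := by
    rw [iteratedDeriv_succ, e2]
    simp
  have c1 : ((n - 1 : ℕ) : ℂ) = n - 1 := by
    rw [Nat.cast_sub (Nat.one_le_iff_ne_zero.mpr hn), Nat.cast_one]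
  have c2 : ((n - 1 : ℕ) : ℂ) * ((n - 1 - 1 : ℕ) : ℂ) = ((n : ℂ) - 1) * (n - 2) := by
    rcases n with _ | _ | n
    · simp at hn
    · simp
    · push_cast [Nat.add_sub_cancel]
      ring
  have e2' : iteratedDeriv 2 (fun w : ℂ => w ^ n) w = n * (n - 1) * w ^ (n - 1) / w := by
    rw [e2]
    simp only [h1 (n - 1)]
    rw [c1]
    ring
  have e3' : iteratedDeriv 3 (fun w : ℂ => w ^ n) w
      = n * (n - 1) * (n - 2) * w ^ (n - 1) / w ^ 2 := by
    rw [e3, h1]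
    calc _ = (n : ℂ) * ((n - 1 - 1 : ℕ) : ℂ) * (((n - 1 : ℕ) : ℂ) * w ^ (n - 1 - 1)) / w := by ring
      _ = (n : ℂ) * (((n - 1 : ℕ) : ℂ) * ((n - 1 - 1 : ℕ) : ℂ)) * w ^ (n - 1) / w ^ 2 := by
        rw [h1]
        field_simp
      _ = _ := by
        rw [c2]
        ring
  rw [schwarzian, e2', e3', e1]
  field_simp
  ring

/-- The entropy coefficient `p₂` of the `k`-noid. -/
lemma entropy_zero_knoid (k : ℕ) (hk : 2 < k) (γ : ℂ → ℂ)
    (hγ : ∀ w : ℂ, w ≠ 0 → w ^ k ≠ 1 →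
      γ w = (-1 - (k : ℂ) * (1 / (w ^ k - 1) + 1 / 2)) / w) :
    ∀ w : ℂ, w ≠ 0 → w ^ k ≠ 1 →
      entropy (fun w => w ^ (k - 1)) γ 0 w
        = (C (-(k : ℂ) ^ 2 / 4 + k - 1 / 2) - C ((k : ℂ) ^ 2 / 2) * X ^ 2).eval
            (1 / (w ^ k - 1) + 1 / 2) / w ^ (0 + 2) := by
  intro w hw hw1
  have hloc : γ =ᶠ[nhds w] fun w => (-1 - (k : ℂ) * (1 / (w ^ k - 1) + 1 / 2)) / w := by
    filter_upwards [isOpen_ne.mem_nhds hw,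
      (isOpen_ne.preimage (continuous_pow k)).mem_nhds hw1] with y hy hy1
    exact hγ y hy hy1
  have hs := hasDerivAt_one_div_pow_sub_one k (by omega) w hw hw1
  have hd := ((hs.const_mul (k : ℂ)).const_sub (-1)).div (hasDerivAt_id w) hw
  have hd' : deriv γ w = _ := hloc.deriv_eq.trans hd.deriv
  change schwarzian (fun w => w ^ (k - 1)) w + γ w ^ 2 / 2 - deriv γ w = _
  rw [schwarzian_pow (k - 1) (by omega) w hw, hd', hγ w hw hw1,
    Nat.cast_sub (by omega : 1 ≤ k)]
  simp only [eval_mul, eval_sub, eval_pow, eval_X, eval_C, id]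
  generalize 1 / (w ^ k - 1) + 1 / 2 = s
  push_cast
  field_simp
  ring

/-- **The Jorge–Meeks `k`-noids have degree 7.**
For an integer `k > 2`, on `U = {z ≠ 0 : z^k ≠ 1}`, with Gauss map `G(z) = z^{k−1}`
and connection coefficient `γ(z) = (k−2)/(2z) − k z^{k−1}/(z^k − 1)` (Hopf
differential `−(k−1)z^{k−2}/(z^k−1)² dz²`), the entropy coefficients satisfy
`p₇ + a_k·p₅·p₂ + b_k·p₄·p₃ + c_k·p₃·p₂² = 0`, where
`a_k = 16(3k−2)(k−2)/(3k²−16k+8)`,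
`b_k = 8(27k⁴−144k³−56k²+128k−32)/((3k²−16k+8)(k−2)(3k−2))`,
`c_k = 192k²/(3k²−16k+8)`. -/
theorem knoid_degree_seven (k : ℕ) (hk : 2 < k) :
    ∀ z : ℂ, z ≠ 0 → z ^ k ≠ 1 →
      entropy (fun w => w ^ (k - 1))
          (fun w => ((k : ℂ) - 2) / (2 * w) - (k : ℂ) * w ^ (k - 1) / (w ^ k - 1)) 5 z
        + (16 * (3 * (k : ℂ) - 2) * ((k : ℂ) - 2)
              / (3 * (k : ℂ) ^ 2 - 16 * (k : ℂ) + 8))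
          * entropy (fun w => w ^ (k - 1))
              (fun w => ((k : ℂ) - 2) / (2 * w) - (k : ℂ) * w ^ (k - 1) / (w ^ k - 1)) 3 z
          * entropy (fun w => w ^ (k - 1))
              (fun w => ((k : ℂ) - 2) / (2 * w) - (k : ℂ) * w ^ (k - 1) / (w ^ k - 1)) 0 z
        + (8 * (27 * (k : ℂ) ^ 4 - 144 * (k : ℂ) ^ 3 - 56 * (k : ℂ) ^ 2
                  + 128 * (k : ℂ) - 32)
              / ((3 * (k : ℂ) ^ 2 - 16 * (k : ℂ) + 8) * ((k : ℂ) - 2) * (3 * (k : ℂ) - 2)))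
          * entropy (fun w => w ^ (k - 1))
              (fun w => ((k : ℂ) - 2) / (2 * w) - (k : ℂ) * w ^ (k - 1) / (w ^ k - 1)) 2 z
          * entropy (fun w => w ^ (k - 1))
              (fun w => ((k : ℂ) - 2) / (2 * w) - (k : ℂ) * w ^ (k - 1) / (w ^ k - 1)) 1 z
        + (192 * (k : ℂ) ^ 2 / (3 * (k : ℂ) ^ 2 - 16 * (k : ℂ) + 8))
          * entropy (fun w => w ^ (k - 1))
              (fun w => ((k : ℂ) - 2) / (2 * w) - (k : ℂ) * w ^ (k - 1) / (w ^ k - 1)) 1 z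
          * (entropy (fun w => w ^ (k - 1))
              (fun w => ((k : ℂ) - 2) / (2 * w) - (k : ℂ) * w ^ (k - 1) / (w ^ k - 1)) 0 z) ^ 2
        = 0 := by
  intro z hz hz1
  have hγ : ∀ w : ℂ, w ≠ 0 → w ^ k ≠ 1 →
      (fun w => ((k : ℂ) - 2) / (2 * w) - (k : ℂ) * w ^ (k - 1) / (w ^ k - 1)) w
        = (-1 - (k : ℂ) * (1 / (w ^ k - 1) + 1 / 2)) / w := by
    intro w hw hw1
    have hsub : w ^ k - 1 ≠ 0 := sub_ne_zero.mpr hw1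
    obtain ⟨m, rfl⟩ : ∃ m, k = m + 1 := ⟨k - 1, by omega⟩
    simp only [Nat.add_sub_cancel]
    field_simp
    ring
  generalize (fun w => ((k : ℂ) - 2) / (2 * w) - (k : ℂ) * w ^ (k - 1) / (w ^ k - 1)) = γ at hγ ⊢
  have hk0 : 0 < k := by omega
  have h0 := entropy_zero_knoid k hk γ hγ
  obtain ⟨c, hc⟩ : ∃ c : ℂ, c = -(k : ℂ) * (3 * k - 2) * (k - 2) / 4 := ⟨_, rfl⟩
  have h1 := entropy_succ_knoid k hk0 _ γ hγ 0 _
    (C c * X) h0 (by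
      intro s
      simp [hc]
      ring)
  have h2 := entropy_succ_knoid k hk0 _ γ hγ 1 _
    (C (c * k) * (2 * X ^ 2 + C (1 / 4))) h1 (by
      intro s
      simp
      ring)
  have h3 := entropy_succ_knoid k hk0 _ γ hγ 2 _
    (C (c * k ^ 2) * (4 * X ^ 3 + 2 * X)) h2 (by
      intro s
      simp
      ring)
  have h4 := entropy_succ_knoid k hk0 _ γ hγ 3 _
    (C (c * k ^ 3) * (8 * X ^ 4 + 11 * X ^ 2 + C (1 / 2))) h3 (by
      intro s
      simp [derivative_pow]
      ring)
  have h5 := entropy_succ_knoid k hk0 _ γ hγ 4 _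
    (C (c * k ^ 4) * (16 * X ^ 5 + 52 * X ^ 3 + C (17 / 2) * X)) h4 (by
      intro s
      simp [derivative_pow]
      ring)
  have hq : 3 * (k : ℂ) ^ 2 - 16 * k + 8 ≠ 0 := by
    have : 3 * (k : ℤ) ^ 2 - 16 * k + 8 ≠ 0 := by
      intro h
      have h6 : k < 6 := by
        by_contra! h6
        have : (6 : ℤ) ≤ k := by exact_mod_cast h6
        nlinarith
      interval_cases k <;> norm_num at h
    exact_mod_cast this
  have hk2 : (k : ℂ) - 2 ≠ 0 := by
    have : (k : ℤ) - 2 ≠ 0 := by omega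
    exact_mod_cast this
  have hk3 : 3 * (k : ℂ) - 2 ≠ 0 := by
    have : 3 * (k : ℤ) - 2 ≠ 0 := by omega
    exact_mod_cast this
  have e0 := h0 z hz hz1
  have e1 := h1 z hz hz1
  have e2 := h2 z hz hz1
  have e3 := h3 z hz hz1
  have e5 := h5 z hz hz1
  simp only [zero_add, Nat.reduceAdd] at e0 e1 e2 e3 e5
  rw [e0, e1, e2, e3, e5]
  simp only [eval_add, eval_sub, eval_mul, eval_pow, eval_X, eval_C, eval_ofNat]
  generalize 1 / (z ^ k - 1) + 1 / 2 = s
  subst hc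
  generalize hqd : 3 * (k : ℂ) ^ 2 - 16 * k + 8 = q at hq ⊢
  field_simp
  rw [← hqd]
  ring
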